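/- Let (R,m) be a Noetherian local ring and let (S,n) be a Noetherian local ring that is an integral ring extension of R. If M is an S-module that is a balanced big Cohen-Macaulay module over R (i.e., every system of parameters of R is a regular sequence on M and mM ≠ M), then M is a balanced big Cohen-Macaulay module over S. -/

import Mathlib

open IsLocalRing

universe u v w

/-- `x` is a system of parameters of the local ring `R`: a sequence of `dim R` elements
of the maximal ideal generating an ideal primary to the maximal ideal. -/
def IsSOP (R : Type*) [CommRing R] [IsLocalRing R] {n : ℕ} (x : Fin n → R) : Prop :=
  (n : WithBot ℕ∞) = ringKrullDim R ∧
  (∀ i, x i ∈ maximalIdeal R) ∧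
  (Ideal.span (Set.range x)).radical = maximalIdeal R

/-- The sequence `x` of elements of `R` is a regular sequence on the `R`-module `M`. -/
def IsRegSeq (R : Type*) [CommRing R] (M : Type*) [AddCommGroup M] [Module R M]
    {n : ℕ} (x : Fin n → R) : Prop :=
  RingTheory.Sequence.IsRegular M (List.ofFn x)

/-- `B` is a big Cohen-Macaulay algebra over the local ring `R`: some system of
parameters of `R` is a regular sequence on `B` (and in particular `mB ≠ B`). -/
def IsBigCM (R : Type*) [CommRing R] [IsLocalRing R]
    (B : Type*) [CommRing B] [Algebra R B] : Prop :=
  (∃ (n : ℕ) (x : Fin n → R), IsSOP R x ∧ IsRegSeq R B x) ∧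
  (maximalIdeal R).map (algebraMap R B) ≠ ⊤

/-- `B` is a balanced big Cohen-Macaulay algebra over the local ring `R`: every system of
parameters of `R` is a regular sequence on `B` (and in particular `mB ≠ B`). -/
def IsBalancedBigCM (R : Type*) [CommRing R] [IsLocalRing R]
    (B : Type*) [CommRing B] [Algebra R B] : Prop :=
  (∀ (n : ℕ) (x : Fin n → R), IsSOP R x → IsRegSeq R B x) ∧
  (maximalIdeal R).map (algebraMap R B) ≠ ⊤

/-- `S` is a seed over the local ring `R`: `S` admits an `R`-algebra homomorphism to some
big Cohen-Macaulay `R`-algebra. -/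
def IsSeed (R : Type u) [CommRing R] [IsLocalRing R]
    (S : Type v) [CommRing S] [Algebra R S] : Prop :=
  ∃ (B : Type (max u v)) (_ : CommRing B) (_ : Algebra R B),
    IsBigCM R B ∧ Nonempty (S →ₐ[R] B)

/-- `M` is a balanced big Cohen-Macaulay module over the local ring `R`: every system of
parameters of `R` is a regular sequence on `M`, and `mM ≠ M`. -/
def IsBalancedBigCMMod (R : Type*) [CommRing R] [IsLocalRing R]
    (M : Type*) [AddCommGroup M] [Module R M] : Prop :=
  (∀ (n : ℕ) (x : Fin n → R), IsSOP R x → IsRegSeq R M x) ∧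
  (maximalIdeal R) • (⊤ : Submodule R M) ≠ ⊤

open Function in
theorem QuotSMulTop.map_injective_of_exact {A : Type*} [CommRing A] {r : A}
    {L N P : Type*} [AddCommGroup L] [Module A L] [AddCommGroup N] [Module A N]
    [AddCommGroup P] [Module A P] {f : L →ₗ[A] N} {g : N →ₗ[A] P}
    (hf : Injective f) (hfg : Exact f g) (hP : IsSMulRegular P r) :
    Injective (QuotSMulTop.map r f) := by
  have := map_first_exact_on_four_term_exact_of_isSMulRegular_last
    (f₁ := (0 : L →ₗ[A] L)) ((LinearMap.exact_zero_iff_injective L f).2 hf) hfg hP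
  rw [map_zero] at this
  exact (LinearMap.exact_zero_iff_injective _ _).1 this

open Function in
/-- If each of `L` and `P` is a submodule of `N` with quotient the other one, then every
weakly regular sequence on `N` is weakly regular on `L`. -/
theorem RingTheory.Sequence.IsWeaklyRegular.of_exact_of_exact {A : Type*} [CommRing A] (rs : List A)
    {L N P : Type*} [AddCommGroup L] [Module A L] [AddCommGroup N] [Module A N]
    [AddCommGroup P] [Module A P]
    {f : L →ₗ[A] N} {g : N →ₗ[A] P} {f' : P →ₗ[A] N} {g' : N →ₗ[A] L}
    (hf : Injective f) (hfg : Exact f g) (hg : Surjective g)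
    (hf' : Injective f') (hfg' : Exact f' g') (hg' : Surjective g')
    (h : IsWeaklyRegular N rs) : IsWeaklyRegular L rs := by
  induction rs generalizing L N P with
  | nil => exact .nil A L
  | cons r rs ih =>
    rw [isWeaklyRegular_cons_iff] at h ⊢
    have hL : IsSMulRegular L r := h.1.of_injective f hf
    have hP : IsSMulRegular P r := h.1.of_injective f' hf'
    exact ⟨hL, ih (QuotSMulTop.map_injective_of_exact hf hfg hP) (QuotSMulTop.map_exact r hfg hg)
      (QuotSMulTop.map_surjective r hg)
      (QuotSMulTop.map_injective_of_exact hf' hfg' hL) (QuotSMulTop.map_exact r hfg' hg')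
      (QuotSMulTop.map_surjective r hg') h.2⟩

open Function Pointwise in
/-- The head of a weakly regular sequence may be replaced by any of its factors. -/
theorem RingTheory.Sequence.IsWeaklyRegular.of_cons_of_smul_eq {A : Type*} [CommRing A] {M : Type*} [AddCommGroup M]
    [Module A M] {a b c : A} {rs : List A} (hc : ∀ m : M, c • m = a • b • m)
    (h : IsWeaklyRegular M (c :: rs)) : IsWeaklyRegular M (a :: rs) := by
  rw [isWeaklyRegular_cons_iff] at h ⊢
  obtain ⟨hreg, hrs⟩ := h
  have hc' (m : M) : c • m = b • a • m := by rw [hc, smul_comm]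
  have ha : IsSMulRegular M a := fun m n hmn ↦ hreg <| by
    simp only [hc']; exact congrArg (b • ·) hmn
  have hb : IsSMulRegular M b := fun m n hmn ↦ hreg <| by
    simp only [hc]; exact congrArg (a • ·) hmn
  -- `M/aM → M/cM → M/bM`, where `c` acts as `a b`; the first map is multiplication by `b`.
  have key {a b : A} (hb : IsSMulRegular M b) (hc : ∀ m : M, c • m = a • b • m)
      (hc' : ∀ m : M, c • m = b • a • m) :
      ∃ (f : QuotSMulTop a M →ₗ[A] QuotSMulTop c M) (g : QuotSMulTop c M →ₗ[A] QuotSMulTop b M),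
        Injective f ∧ Exact f g ∧ Surjective g := by
    have hle : a • (⊤ : Submodule A M) ≤
        (c • (⊤ : Submodule A M)).comap (LinearMap.lsmul A M b) := by
      rintro _ ⟨m, -, rfl⟩
      exact ⟨m, trivial, hc' m⟩
    have hle' : c • (⊤ : Submodule A M) ≤ (b • (⊤ : Submodule A M)).comap LinearMap.id := by
      rintro _ ⟨m, -, rfl⟩
      exact ⟨a • m, trivial, (hc' m).symm⟩
    refine ⟨Submodule.mapQ _ _ (LinearMap.lsmul A M b) hle, Submodule.mapQ _ _ LinearMap.id hle',
      ?_, ?_, ?_⟩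
    · rw [← LinearMap.ker_eq_bot, LinearMap.ker_eq_bot']
      intro m hm
      obtain ⟨m, rfl⟩ := Submodule.Quotient.mk_surjective _ m
      rw [Submodule.mapQ_apply, Submodule.Quotient.mk_eq_zero] at hm
      obtain ⟨n, -, hn⟩ := hm
      rw [Submodule.Quotient.mk_eq_zero]
      exact ⟨n, trivial, hb ((hc' n).symm.trans hn)⟩
    · intro m
      obtain ⟨m, rfl⟩ := Submodule.Quotient.mk_surjective _ m
      rw [Submodule.mapQ_apply, Submodule.Quotient.mk_eq_zero]
      constructor
      · rintro ⟨n, -, hn⟩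
        exact ⟨Submodule.Quotient.mk n, congrArg Submodule.Quotient.mk hn⟩
      · rintro ⟨n, hn⟩
        obtain ⟨n, rfl⟩ := Submodule.Quotient.mk_surjective _ n
        rw [Submodule.mapQ_apply, Submodule.Quotient.eq] at hn
        obtain ⟨k, -, hk⟩ := hn
        refine ⟨n - a • k, trivial, ?_⟩
        change c • k = b • n - m at hk
        change b • (n - a • k) = m
        rw [smul_sub, ← hc', hk, sub_sub_cancel]
    · intro m
      obtain ⟨m, rfl⟩ := Submodule.Quotient.mk_surjective _ m
      exact ⟨Submodule.Quotient.mk m, rfl⟩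
  obtain ⟨f, g, hf, hfg, hg⟩ := key hb hc hc'
  obtain ⟨f', g', hf', hfg', hg'⟩ := key ha hc' hc
  exact ⟨ha, .of_exact_of_exact rs hf hfg hg hf' hfg' hg' hrs⟩

open Pointwise in
/-- If `xs` is weakly regular on `M` and each `xᵢ` lies in the ideal generated by
`y₀, …, yᵢ` modulo the annihilator of `M`, then `ys` is weakly regular on `M`. -/
theorem RingTheory.Sequence.IsWeaklyRegular.of_getElem_mem_ofList_take {A : Type*} [CommRing A] {M : Type*}
    [AddCommGroup M] [Module A M] {xs ys : List A} (hlen : xs.length = ys.length)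
    (hmem : ∀ (i : ℕ) (hi : i < xs.length),
      xs[i] ∈ Module.annihilator A M ⊔ Ideal.ofList (ys.take (i + 1)))
    (h : IsWeaklyRegular M xs) : IsWeaklyRegular M ys := by
  induction ys generalizing M xs with
  | nil => exact .nil A M
  | cons a ys ih =>
    obtain _ | ⟨c, xs⟩ := xs
    · simp at hlen
    have hc := hmem 0 (by simp)
    simp only [List.getElem_cons_zero, zero_add, List.take_succ_cons, List.take_zero,
      Ideal.ofList_singleton] at hc
    obtain ⟨z, hz, w, hw, rfl⟩ := Submodule.mem_sup.1 hc
    obtain ⟨b, rfl⟩ := Ideal.mem_span_singleton'.1 hw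
    have h' : IsWeaklyRegular M (a :: xs) := .of_cons_of_smul_eq (b := b) (fun m ↦ by
      rw [add_smul, Module.mem_annihilator.1 hz, zero_add, mul_comm, mul_smul]) h
    rw [isWeaklyRegular_cons_iff] at h' ⊢
    refine ⟨h'.1, ih (by simpa using hlen) (fun i hi ↦ ?_) h'.2⟩
    have hi' := hmem (i + 1) (by simpa using hi)
    simp only [List.getElem_cons_succ, List.take_succ_cons, Ideal.ofList_cons] at hi'
    refine SetLike.le_def.1 (sup_le ?_ (sup_le ?_ ?_)) hi'
    · exact le_sup_of_le_left
        ((Submodule.mkQ (a • (⊤ : Submodule A M))).annihilator_le_of_surjective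
          (Submodule.mkQ_surjective _))
    · rw [Ideal.span_singleton_le_iff_mem]
      exact Ideal.mem_sup_left (QuotSMulTop.mem_annihilator M a)
    · exact le_sup_right

theorem ringKrullDim_eq_of_isIntegral_of_injective {A B : Type*} [CommRing A] [CommRing B]
    [Algebra A B] [Algebra.IsIntegral A B] (hinj : Function.Injective (algebraMap A B)) :
    ringKrullDim A = ringKrullDim B := by
  refine le_antisymm (iSup_le fun l ↦ ?_) ?_
  · obtain ⟨Q, -, hQ, hQl⟩ := Ideal.exists_ideal_over_prime_of_isIntegral l.head.asIdeal
      (⊥ : Ideal B) (by simp [← RingHom.ker_eq_comap_bot, (RingHom.injective_iff_ker_eq_bot _).1 hinj])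
    have : Q.LiesOver l.head.asIdeal := ⟨hQl.symm⟩
    obtain ⟨L, hL, -⟩ := Ideal.exists_ltSeries_of_hasGoingUp l Q
    rw [← hL]
    exact le_iSup (fun p : LTSeries (PrimeSpectrum B) ↦ (p.length : WithBot ℕ∞)) L
  · exact Order.krullDim_le_of_strictMono (PrimeSpectrum.comap (algebraMap A B))
      fun p q hpq ↦ Ideal.IsIntegral.comap_lt_comap hpq

theorem ringKrullDim_quotient_comap_eq {A B : Type*} [CommRing A] [CommRing B]
    [Algebra A B] [Algebra.IsIntegral A B] (I : Ideal B) :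
    ringKrullDim (A ⧸ I.comap (algebraMap A B)) = ringKrullDim (B ⧸ I) :=
  ringKrullDim_eq_of_isIntegral_of_injective Ideal.algebraMap_quotient_injective

theorem exists_mem_ringKrullDim_quotient_sup_span_singleton_le {A : Type*} [CommRing A]
    [IsNoetherianRing A] {K J : Ideal A} {n : ℕ}
    (hK : ringKrullDim (A ⧸ K) ≤ (n + 1 : ℕ)) (hJ : ringKrullDim (A ⧸ J) ≤ n) :
    ∃ x ∈ J, ringKrullDim (A ⧸ K ⊔ Ideal.span {x}) ≤ n := by
  have hfin : {p ∈ K.minimalPrimes | ¬ J ≤ p}.Finite :=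
    K.finite_minimalPrimes_of_isNoetherianRing.subset fun _ hp ↦ hp.1
  obtain ⟨x, hxJ, hx⟩ : ∃ x ∈ J, ∀ p ∈ K.minimalPrimes, ¬ J ≤ p → x ∉ p := by
    by_contra! hcon
    obtain ⟨p, hp, hJp⟩ := (Ideal.subset_union_prime_finite hfin (f := id) ⊥ ⊥
      fun p hp _ _ ↦ hp.1.1.1).1 (fun x hx ↦ by
        obtain ⟨p, hp, hJp, hxp⟩ := hcon x hx
        exact Set.mem_biUnion (⟨hp, hJp⟩ : p ∈ {p ∈ K.minimalPrimes | ¬ J ≤ p}) hxp)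
    exact hp.2 hJp
  refine ⟨x, hxJ, ?_⟩
  rw [ringKrullDim_quotient] at hK hJ ⊢
  refine iSup_le fun l ↦ ?_
  have hhead : K ⊔ Ideal.span {x} ≤ l.head.1.asIdeal := l.head.2
  have hxl : x ∈ l.head.1.asIdeal := hhead (Ideal.mem_sup_right (Ideal.mem_span_singleton_self x))
  obtain ⟨p, hp, hpl⟩ := Ideal.exists_minimalPrimes_le (le_sup_left.trans hhead)
  by_cases hJp : J ≤ p
  · have hmem (i) : (l i).1 ∈ PrimeSpectrum.zeroLocus (R := A) J :=
      (hJp.trans hpl).trans (l.head_le i)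
    let L : LTSeries (PrimeSpectrum.zeroLocus (R := A) J) :=
      LTSeries.mk l.length (fun i ↦ ⟨(l i).1, hmem i⟩) fun _ _ h ↦ l.strictMono h
    exact (le_iSup (fun q : LTSeries _ ↦ (q.length : WithBot ℕ∞)) L).trans hJ
  · let φ (q : PrimeSpectrum.zeroLocus (R := A) (K ⊔ Ideal.span {x} : Ideal A)) :
        PrimeSpectrum.zeroLocus (R := A) K := ⟨q.1, fun _ hy ↦ q.2 (Ideal.mem_sup_left hy)⟩
    have hφ : StrictMono φ := fun _ _ h ↦ h
    let P : PrimeSpectrum.zeroLocus (R := A) K := ⟨⟨p, hp.1.1⟩, hp.1.2⟩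
    have hP : P < (l.map φ hφ).head :=
      lt_of_le_of_ne hpl fun h ↦ hx p hp hJp <| by
        have : p = l.head.1.asIdeal := congrArg (fun q ↦ q.1.asIdeal) h
        rwa [this]
    have := (le_iSup (fun q : LTSeries _ ↦ (q.length : WithBot ℕ∞))
      ((l.map φ hφ).cons P hP)).trans hK
    rw [RelSeries.cons_length] at this
    have : l.length + 1 ≤ n + 1 := by exact_mod_cast this
    exact_mod_cast Nat.le_of_succ_le_succ this

theorem ringKrullDim_quotient_le_add_length {A : Type*} [CommRing A] [IsLocalRing A]
    [IsNoetherianRing A] (I : Ideal A) (ys : List A) (hys : ∀ y ∈ ys, y ∈ maximalIdeal A) :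
    ringKrullDim (A ⧸ I) ≤ ringKrullDim (A ⧸ I ⊔ Ideal.ofList ys) + ys.length := by
  obtain rfl | hI := eq_or_ne I ⊤
  · have := Ideal.Quotient.subsingleton_iff.2 (rfl : (⊤ : Ideal A) = ⊤)
    simp [ringKrullDim_eq_bot_of_subsingleton]
  have := Ideal.Quotient.nontrivial_iff.2 hI
  have := IsLocalRing.of_surjective' (Ideal.Quotient.mk I) Ideal.Quotient.mk_surjective
  classical
  have h := ringKrullDim_le_ringKrullDim_quotient_add_card
    (ys.map (Ideal.Quotient.mk I)).toFinset (by
      intro z hz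
      rw [List.coe_toFinset] at hz
      obtain ⟨y, hy, rfl⟩ := List.mem_map.1 hz
      rw [IsLocalRing.ringJacobson_eq_maximalIdeal]
      have := Ideal.Quotient.mk_surjective (I := I).isLocalHom
      exact fun hu ↦ hys y hy (isUnit_of_map_unit (Ideal.Quotient.mk I) y hu))
  have he : Ideal.span ((ys.map (Ideal.Quotient.mk I)).toFinset : Set (A ⧸ I)) =
      (Ideal.ofList ys).map (Ideal.Quotient.mk I) := by
    rw [Ideal.map_ofList, List.coe_toFinset]
  rw [he, ringKrullDim_eq_of_ringEquiv (DoubleQuot.quotQuotEquivQuotSup _ _)] at h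
  refine h.trans (add_le_add_right ?_ _)
  exact_mod_cast (List.toFinset_card_le _).trans_eq (List.length_map _)

theorem radical_eq_maximalIdeal_of_ringKrullDim_quotient_le_zero {A : Type*} [CommRing A]
    [IsLocalRing A] {I : Ideal A} (hI : I ≤ maximalIdeal A)
    (hdim : ringKrullDim (A ⧸ I) ≤ 0) : I.radical = maximalIdeal A := by
  rw [ringKrullDim_quotient, Order.krullDim_nonpos_iff_forall_isMax] at hdim
  refine le_antisymm ((Ideal.IsPrime.radical_le_iff inferInstance).2 hI) ?_
  rw [Ideal.radical_eq_sInf]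
  refine le_sInf fun p hp ↦ ?_
  exact hdim ⟨⟨p, hp.2⟩, hp.1⟩ (b := ⟨closedPoint A, hI⟩) (le_maximalIdeal hp.2.ne_top)

theorem ringKrullDim_quotient_le_zero_of_radical_eq_maximalIdeal {A : Type*} [CommRing A]
    [IsLocalRing A] {I : Ideal A} (hI : I.radical = maximalIdeal A) :
    ringKrullDim (A ⧸ I) ≤ 0 := by
  rw [ringKrullDim_quotient, Order.krullDim_nonpos_iff_forall_isMax]
  intro p q _
  have : maximalIdeal A ≤ p.1.asIdeal := hI ▸ (p.1.2.radical_le_iff.2 p.2)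
  exact (le_maximalIdeal q.1.2.ne_top).trans this

/-- If `dim A/Jᵢ ≤ n - i` for all `i ≤ n`, one can choose elements `xᵢ ∈ J (i + 1)` cutting
the dimension down by one at each step. -/
theorem exists_list_getElem_mem_ringKrullDim_quotient_le {A : Type*} [CommRing A]
    [IsNoetherianRing A] {J : ℕ → Ideal A} {n : ℕ} (hA : ringKrullDim A ≤ n)
    (hdim : ∀ i ≤ n, ringKrullDim (A ⧸ J i) ≤ (n - i : ℕ)) (k : ℕ) (hk : k ≤ n) :
    ∃ xs : List A, xs.length = k ∧ (∀ (i : ℕ) (hi : i < xs.length), xs[i] ∈ J (i + 1)) ∧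
      ringKrullDim (A ⧸ Ideal.ofList xs) ≤ (n - k : ℕ) := by
  induction k with
  | zero =>
    exact ⟨[], rfl, by simp, (ringKrullDim_quotient_le _).trans (by simpa using hA)⟩
  | succ k ih =>
    obtain ⟨xs, hlen, hxs, hd⟩ := ih (by omega)
    rw [show n - k = n - (k + 1) + 1 by omega] at hd
    obtain ⟨x, hx, hxd⟩ :=
      exists_mem_ringKrullDim_quotient_sup_span_singleton_le hd (hdim (k + 1) hk)
    refine ⟨xs ++ [x], by simp [hlen], fun i hi ↦ ?_, ?_⟩
    · rw [List.getElem_append]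
      split_ifs with h
      · exact hxs i h
      · obtain rfl : i = k := by simp at hi; omega
        simpa using hx
    · rwa [Ideal.ofList_append, Ideal.ofList_singleton]

/-- In a local ring extension that is integral, every system of parameters `y` of the big ring
admits a system of parameters `x` of the small ring with `xᵢ ∈ (y₀, …, yᵢ)`. -/
theorem IsSOP.exists_list_of_isIntegral {A B : Type*} [CommRing A] [IsLocalRing A]
    [IsNoetherianRing A] [CommRing B] [IsLocalRing B] [IsNoetherianRing B] [Algebra A B]
    (hinj : Function.Injective (algebraMap A B)) [Algebra.IsIntegral A B]
    {n : ℕ} {y : Fin n → B} (hy : IsSOP B y) :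
    ∃ x : Fin n → A, IsSOP A x ∧ ∀ (i : ℕ) (hi : i < n),
      algebraMap A B (x ⟨i, hi⟩) ∈ Ideal.ofList ((List.ofFn y).take (i + 1)) := by
  obtain ⟨hdim, hmem, hrad⟩ := hy
  have hmem' : ∀ z ∈ List.ofFn y, z ∈ maximalIdeal B := by simpa [List.forall_mem_ofFn_iff]
  have hofList : Ideal.ofList (List.ofFn y) = Ideal.span (Set.range y) := by
    simp [Ideal.ofList, List.mem_ofFn', Set.range]
  let J (i : ℕ) : Ideal A := (Ideal.ofList ((List.ofFn y).take i)).comap (algebraMap A B)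
  have hdimA : ringKrullDim A = n :=
    (ringKrullDim_eq_of_isIntegral_of_injective hinj).trans hdim.symm
  have hJ (i : ℕ) (hi : i ≤ n) : ringKrullDim (A ⧸ J i) ≤ (n - i : ℕ) := by
    rw [ringKrullDim_quotient_comap_eq]
    have h := ringKrullDim_quotient_le_add_length (Ideal.ofList ((List.ofFn y).take i))
      ((List.ofFn y).drop i) fun z hz ↦ hmem' z (List.mem_of_mem_drop hz)
    rw [← Ideal.ofList_append, List.take_append_drop, hofList, List.length_drop,
      List.length_ofFn] at h
    refine h.trans ?_
    simpa using add_le_add_left (ringKrullDim_quotient_le_zero_of_radical_eq_maximalIdeal hrad)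
      ((n - i : ℕ) : WithBot ℕ∞)
  obtain ⟨xs, rfl, hxs, hxdim⟩ :=
    exists_list_getElem_mem_ringKrullDim_quotient_le hdimA.le hJ n le_rfl
  have hxmem (i : ℕ) (hi : i < xs.length) : xs[i] ∈ maximalIdeal A := by
    have : Ideal.ofList ((List.ofFn y).take (i + 1)) ≤ maximalIdeal B :=
      Ideal.span_le.2 fun z hz ↦ hmem' z (List.mem_of_mem_take hz)
    exact fun hu ↦ this (hxs i hi) (hu.map (algebraMap A B))
  refine ⟨xs.get, ⟨hdimA.symm, fun i ↦ hxmem i i.2, ?_⟩, hxs⟩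
  refine radical_eq_maximalIdeal_of_ringKrullDim_quotient_le_zero ?_ ?_
  · rw [Ideal.span_le]
    rintro _ ⟨i, rfl⟩
    exact hxmem i i.2
  · rw [Set.range_list_get]
    simpa using hxdim

theorem maximalIdeal_smul_top_ne_top_of_isIntegral {A B : Type*} [CommRing A] [IsLocalRing A]
    [CommRing B] [IsLocalRing B] [IsNoetherianRing B] [Algebra A B] [Algebra.IsIntegral A B]
    {M : Type*} [AddCommGroup M] [Module B M] [Module A M] [IsScalarTower A B M]
    (hM : maximalIdeal A • (⊤ : Submodule A M) ≠ ⊤) :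
    maximalIdeal B • (⊤ : Submodule B M) ≠ ⊤ := by
  intro h
  have hrad : maximalIdeal B ≤ ((maximalIdeal A).map (algebraMap A B)).radical := by
    rw [Ideal.radical_eq_sInf]
    refine le_sInf fun p ⟨hp, hprime⟩ ↦ ?_
    have hcomap : p.comap (algebraMap A B) = maximalIdeal A :=
      le_antisymm (le_maximalIdeal (hprime.comap _).ne_top) (Ideal.map_le_iff_le_comap.1 hp)
    have := Ideal.isMaximal_of_isIntegral_of_isMaximal_comap (R := A) p
      (hcomap ▸ maximalIdeal.isMaximal A)
    exact (eq_maximalIdeal this).ge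
  obtain ⟨k, hk⟩ := Ideal.exists_pow_le_of_le_radical_of_fg hrad (IsNoetherian.noetherian _)
  have hpow : maximalIdeal B ^ k • (⊤ : Submodule B M) = ⊤ := by
    clear hk
    induction k with
    | zero => simp
    | succ k ih => rw [pow_succ, Submodule.mul_smul, h, ih]
  have htop : (maximalIdeal A).map (algebraMap A B) • (⊤ : Submodule B M) = ⊤ :=
    top_le_iff.1 (hpow.ge.trans (Submodule.smul_mono_left hk))
  have hA := Ideal.smul_restrictScalars (maximalIdeal A) (⊤ : Submodule B M)
  rw [htop, Submodule.restrictScalars_top] at hA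
  exact hM hA.symm

/-- **Corollary (Dietz, Cor. 4.5 / `bigCMbasechange`).** Let `(S,n)` be a Noetherian local
ring that is an integral extension of a Noetherian local ring `(R,m)`. If `M` is an
`S`-module that is a balanced big Cohen-Macaulay module over `R`, then `M` is a balanced
big Cohen-Macaulay module over `S`. -/
theorem balanced_bigCM_module_of_integral_extension
    (R : Type u) [CommRing R] [IsLocalRing R] [IsNoetherianRing R]
    (S : Type v) [CommRing S] [IsLocalRing S] [IsNoetherianRing S]
    [Algebra R S] (hinj : Function.Injective (algebraMap R S)) [Algebra.IsIntegral R S]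
    (M : Type w) [AddCommGroup M] [Module S M] [Module R M] [IsScalarTower R S M]
    (hM : IsBalancedBigCMMod R M) : IsBalancedBigCMMod S M := by
  have hne := maximalIdeal_smul_top_ne_top_of_isIntegral (B := S) hM.2
  refine ⟨fun n y hy ↦ ⟨?_, fun htop ↦ hne (top_le_iff.1 (htop.le.trans
    (Submodule.smul_mono_left (Ideal.span_le.2 fun z hz ↦ ?_))))⟩, hne⟩
  · obtain ⟨x, hx, hxy⟩ := hy.exists_list_of_isIntegral hinj
    have h := (RingTheory.Sequence.isWeaklyRegular_map_algebraMap_iff S M _).2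
      (hM.1 n x hx).toIsWeaklyRegular
    refine .of_getElem_mem_ofList_take (by simp) (fun i hi ↦ Ideal.mem_sup_right ?_) h
    simpa using hxy i (by simpa using hi)
  · obtain ⟨i, rfl⟩ := (List.mem_ofFn' y z).1 hz
    exact hy.2.1 i
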